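/- (Classical Adams–Hilton theorem, existence part, as reproved in the paper.) Let A and A' be augmented differential graded R-algebras, let g : A → A' be a morphism of differential graded algebras inducing an isomorphism on homology, let V be a free non-negatively graded R-module concentrated in degrees ≥ 1, let d be a differential of degree −1 on the tensor algebra T(V) with d∘d = 0 that is a derivation (d(ab) = d(a)b + (−1)^{|a|} a d(b) for homogeneous a), and let f' : (T(V),d) → A' be a morphism of differential graded algebras. Then there exist a morphism f : (T(V),d) → A of differential graded algebras and a degree-1 R-linear map h : T(V) → A' satisfying d h + h d = g∘f − f' and the derivation rule h(ab) = h(a) f'(b) + (−1)^{|a|} (g∘f)(a) h(b) for homogeneous a, b. -/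

import Mathlib

/-!
Framework: bigraded algebras are treated as internally graded `R`-algebras, i.e.
an `R`-algebra `A` with a family `𝒜 : ℤ × ℤ → Submodule R A` which is an internal
direct sum decomposition, compatible with the multiplication.  A multimorphism of
degree `0` is encoded by its family of components `f : ℕ → (A →ₗ[R] B)`, where
`f k` lowers column degree by `k` and raises row (complementary) degree by `k`;
composition of multimorphisms is by convolution.  For the tensor algebra `T[V]` on
a bigraded module `V` the induced bigrading is generated by products of
homogeneous elements of `V`.
-/

section TensorPreamble

variable (R : Type) [CommRing R]

/-- Convolution composition of multimorphisms: `(g ∘ f)^k = ∑_{i+j=k} g^i f^j`. -/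
def convE {A B C : Type} [AddCommGroup A] [Module R A] [AddCommGroup B] [Module R B]
    [AddCommGroup C] [Module R C] (g : ℕ → (B →ₗ[R] C)) (f : ℕ → (A →ₗ[R] B)) :
    ℕ → (A →ₗ[R] C) :=
  fun k => ∑ i ∈ Finset.range (k + 1), (g i).comp (f (k - i))

/-- The identity multimorphism. -/
def idE (A : Type) [AddCommGroup A] [Module R A] : ℕ → (A →ₗ[R] A) :=
  fun k => if k = 0 then LinearMap.id else 0

/-- Totalization of a multimorphism (pointwise, a finite sum in each argument in the
bounded situations considered below). -/
noncomputable def totE {A B : Type} [AddCommGroup A] [Module R A] [AddCommGroup B]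
    [Module R B] (f : ℕ → (A →ₗ[R] B)) : A → B :=
  fun x => ∑ᶠ k, f k x

variable (V : Type) [AddCommGroup V] [Module R V]

/-- The grading induced on the tensor algebra `T[V]` by a grading `𝒱` of `V`:
the piece of degree `n` is generated by all products of homogeneous elements of `V`
whose degrees add up to `n`. -/
def tGrade {ι : Type} [AddCommMonoid ι] (𝒱 : ι → Submodule R V) (n : ι) :
    Submodule R (TensorAlgebra R V) :=
  ⨆ (l : List ι) (_ : l.sum = n),
    (l.map fun i => Submodule.map (TensorAlgebra.ι R (M := V)) (𝒱 i)).prod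

/-- `V` (with grading `𝒱`) is a generating bigraded module for a free connected
multialgebra: the grading is an internal direct sum decomposition, concentrated in
strictly positive total degrees, and bounded below. -/
def IsFreeConnectedGen (𝒱 : ℤ × ℤ → Submodule R V) : Prop :=
  DirectSum.IsInternal 𝒱 ∧
  (∀ pq : ℤ × ℤ, pq.1 + pq.2 ≤ 0 → 𝒱 pq = ⊥) ∧
  (∀ n : ℤ, ∃ s : ℤ, ∀ pq : ℤ × ℤ, pq.1 + pq.2 = n → pq.1 < s → 𝒱 pq = ⊥)

/-- A multialgebra structure: `𝒜` is an internal bigrading of the `R`-algebra `A`,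
bounded below, and `d` is a multidifferential each of whose components satisfies the
Leibniz rule. -/
def IsMultialgebra (A : Type) [Ring A] [Algebra R A] (𝒜 : ℤ × ℤ → Submodule R A)
    (d : ℕ → (A →ₗ[R] A)) : Prop :=
  DirectSum.IsInternal 𝒜 ∧
  (1 : A) ∈ 𝒜 (0, 0) ∧
  (∀ pq pq' : ℤ × ℤ, ∀ a ∈ 𝒜 pq, ∀ b ∈ 𝒜 pq', a * b ∈ 𝒜 (pq.1 + pq'.1, pq.2 + pq'.2)) ∧
  (∀ n : ℤ, ∃ s : ℤ, ∀ pq : ℤ × ℤ, pq.1 + pq.2 = n → pq.1 < s → 𝒜 pq = ⊥) ∧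
  (∀ (i : ℕ) (pq : ℤ × ℤ), ∀ a ∈ 𝒜 pq, d i a ∈ 𝒜 (pq.1 - i, pq.2 + i - 1)) ∧
  (∀ (i : ℕ) (pq : ℤ × ℤ), ∀ a ∈ 𝒜 pq, ∀ b : A,
    d i (a * b) = d i a * b + (((-1 : ℤˣ) ^ (pq.1 + pq.2) : ℤˣ) : ℤ) • (a * d i b)) ∧
  (∀ n : ℕ, ∑ i ∈ Finset.range (n + 1), (d i).comp (d (n - i)) = 0)

/-- A morphism of multialgebras `(A, 𝒜, dA) → (B, ℬ, dB)`, given by its components. -/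
def IsMAlgMorphism {A B : Type} [Ring A] [Algebra R A] [Ring B] [Algebra R B]
    (𝒜 : ℤ × ℤ → Submodule R A) (ℬ : ℤ × ℤ → Submodule R B)
    (dA : ℕ → (A →ₗ[R] A)) (dB : ℕ → (B →ₗ[R] B)) (f : ℕ → (A →ₗ[R] B)) : Prop :=
  (∀ (k : ℕ) (pq : ℤ × ℤ), ∀ a ∈ 𝒜 pq, f k a ∈ ℬ (pq.1 - k, pq.2 + k)) ∧
  (∀ k, ∑ i ∈ Finset.range (k + 1), (dB i).comp (f (k - i)) =
    ∑ i ∈ Finset.range (k + 1), (f i).comp (dA (k - i))) ∧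
  (f 0 1 = 1) ∧ (∀ k, 0 < k → f k 1 = 0) ∧
  (∀ (k : ℕ) (a b : A), f k (a * b) = ∑ i ∈ Finset.range (k + 1), f i a * f (k - i) b)

/-- A multihomotopy of morphisms of multialgebras from `f` to `g`: `H k` encodes the
component `h^{k-1}` (so that the component `h^{-1}` is allowed), and `H` is an
`f`-`g`-multiderivation. -/
def IsMAlgHomotopy {A B : Type} [Ring A] [Algebra R A] [Ring B] [Algebra R B]
    (𝒜 : ℤ × ℤ → Submodule R A) (ℬ : ℤ × ℤ → Submodule R B)
    (dA : ℕ → (A →ₗ[R] A)) (dB : ℕ → (B →ₗ[R] B)) (f g H : ℕ → (A →ₗ[R] B)) : Prop :=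
  (∀ (k : ℕ) (pq : ℤ × ℤ), ∀ a ∈ 𝒜 pq, H k a ∈ ℬ (pq.1 - k + 1, pq.2 + k)) ∧
  (∀ m, ∑ i ∈ Finset.range (m + 1), ((dB i).comp (H (m - i)) + (H i).comp (dA (m - i))) =
    if m = 0 then 0 else g (m - 1) - f (m - 1)) ∧
  (∀ (k : ℕ) (pq : ℤ × ℤ), ∀ a ∈ 𝒜 pq, ∀ b : A,
    H k (a * b) = ∑ i ∈ Finset.range (k + 1),
      (H i a * g (k - i) b +
        (((-1 : ℤˣ) ^ (pq.1 + pq.2) : ℤˣ) : ℤ) • (f (k - i) a * H i b)))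

/-- A morphism of (internally graded) multicomplexes, given by its components. -/
def IsMCMorphismI {V W : Type} [AddCommGroup V] [Module R V] [AddCommGroup W] [Module R W]
    (𝒱 : ℤ × ℤ → Submodule R V) (𝒲 : ℤ × ℤ → Submodule R W)
    (dV : ℕ → (V →ₗ[R] V)) (dW : ℕ → (W →ₗ[R] W)) (f : ℕ → (V →ₗ[R] W)) : Prop :=
  (∀ (k : ℕ) (pq : ℤ × ℤ), ∀ v ∈ 𝒱 pq, f k v ∈ 𝒲 (pq.1 - k, pq.2 + k)) ∧
  ∀ k, ∑ i ∈ Finset.range (k + 1), (dW i).comp (f (k - i)) =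
    ∑ i ∈ Finset.range (k + 1), (f i).comp (dV (k - i))

/-- A multihomotopy of morphisms of (internally graded) multicomplexes from `f` to `g`;
`H k` encodes the component `h^{k-1}`. -/
def IsMCHomotopyI {V W : Type} [AddCommGroup V] [Module R V] [AddCommGroup W] [Module R W]
    (𝒱 : ℤ × ℤ → Submodule R V) (𝒲 : ℤ × ℤ → Submodule R W)
    (dV : ℕ → (V →ₗ[R] V)) (dW : ℕ → (W →ₗ[R] W)) (f g H : ℕ → (V →ₗ[R] W)) : Prop :=
  (∀ (k : ℕ) (pq : ℤ × ℤ), ∀ v ∈ 𝒱 pq, H k v ∈ 𝒲 (pq.1 - k + 1, pq.2 + k)) ∧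
  ∀ m, ∑ i ∈ Finset.range (m + 1), ((dW i).comp (H (m - i)) + (H i).comp (dV (m - i))) =
    if m = 0 then 0 else g (m - 1) - f (m - 1)

/-- The linear part `β₁` of a multidifferential `d` on `T[V]`: the component of the
restriction of `d` to `V` which lands in `V ⊆ T[V]`. -/
noncomputable def betaOne (d : ℕ → (TensorAlgebra R V →ₗ[R] TensorAlgebra R V)) (i : ℕ) :
    V →ₗ[R] V :=
  (TensorAlgebra.ιInv (R := R) (M := V)).comp ((d i).comp (TensorAlgebra.ι R))

/-- The `q`-th column filtration level of an internally bigraded module. -/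
def colFilI {A : Type} [AddCommGroup A] [Module R A] (𝒜 : ℤ × ℤ → Submodule R A)
    (q : ℤ) : Submodule R A :=
  ⨆ (pq : ℤ × ℤ) (_ : pq.1 ≤ q), 𝒜 pq

/-- The totalization of the multimorphism `g` restricts, on every column filtration
level, to a homology isomorphism (weak multiequivalence, cf. Lemma 1.12.3). -/
def InducesColHomologyIsoI {A B : Type} [AddCommGroup A] [Module R A] [AddCommGroup B]
    [Module R B] (𝒜 : ℤ × ℤ → Submodule R A) (ℬ : ℤ × ℤ → Submodule R B)
    (dA : ℕ → (A →ₗ[R] A)) (dB : ℕ → (B →ₗ[R] B)) (g : ℕ → (A →ₗ[R] B)) : Prop :=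
  ∀ q : ℤ,
    (∀ y ∈ colFilI R ℬ q, totE R dB y = 0 →
      ∃ x ∈ colFilI R 𝒜 q, ∃ z ∈ colFilI R ℬ q,
        totE R dA x = 0 ∧ y = totE R g x + totE R dB z) ∧
    (∀ x ∈ colFilI R 𝒜 q, totE R dA x = 0 →
      (∃ z ∈ colFilI R ℬ q, totE R g x = totE R dB z) →
      ∃ w ∈ colFilI R 𝒜 q, x = totE R dA w)

end TensorPreamble
section Graded

variable {R : Type} [CommRing R] {M N : Type} [AddCommGroup M] [Module R M]
  [AddCommGroup N] [Module R N]

/-- Linear maps given on the pieces of an internal direct sum glue to a linear map. -/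
lemma DirectSum.IsInternal.exists_linearMap {ℳ : ℕ → Submodule R M}
    (hM : DirectSum.IsInternal ℳ) (F : ∀ n, ℳ n →ₗ[R] N) :
    ∃ Φ : M →ₗ[R] N, ∀ n (x : ℳ n), Φ x = F n x := by
  classical
  let e := LinearEquiv.ofBijective (DirectSum.coeLinearMap ℳ) hM
  refine ⟨(DirectSum.toModule R ℕ N F) ∘ₗ e.symm.toLinearMap, fun n x => ?_⟩
  have : e.symm (x : M) = DirectSum.lof R ℕ (fun i => ℳ i) n x := by
    rw [LinearEquiv.symm_apply_eq]
    exact (DirectSum.coeLinearMap_lof ℳ n x).symm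
  simp [this]

lemma DirectSum.IsInternal.linearMap_ext {ℳ : ℕ → Submodule R M}
    (hM : DirectSum.IsInternal ℳ) {φ ψ : M →ₗ[R] N}
    (h : ∀ n, ∀ x ∈ ℳ n, φ x = ψ x) : φ = ψ := by
  classical
  have h_top : LinearMap.eqLocus φ ψ = ⊤ := by
    rw [eq_top_iff, ← hM.submodule_iSup_eq_top]
    exact iSup_le fun n x hx => h n x hx
  ext x
  exact (h_top ▸ Submodule.mem_top : x ∈ LinearMap.eqLocus φ ψ)

lemma DirectSum.IsInternal.exists_proj {ℳ : ℕ → Submodule R M}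
    (hM : DirectSum.IsInternal ℳ) (n : ℕ) :
    ∃ π : M →ₗ[R] ℳ n, (∀ x : ℳ n, π x = x) ∧ ∀ m ≠ n, ∀ x ∈ ℳ m, π x = 0 := by
  classical
  obtain ⟨π, hπ⟩ := hM.exists_linearMap (N := ℳ n)
    fun m => if h : m = n then LinearMap.restrict LinearMap.id (fun x hx => h ▸ hx) else 0
  refine ⟨π, fun x => ?_, fun m hm x hx => ?_⟩
  · rw [hπ]; simp; rfl
  · have := hπ m ⟨x, hx⟩
    simpa [hm] using this

/-- The pieces of an internal direct sum decomposition of a projective module are projective. -/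
lemma DirectSum.IsInternal.projective {ℳ : ℕ → Submodule R M} [Module.Projective R M]
    (hM : DirectSum.IsInternal ℳ) (n : ℕ) : Module.Projective R (ℳ n) := by
  obtain ⟨π, hπ, -⟩ := hM.exists_proj n
  exact Module.Projective.of_split (ℳ n).subtype π (LinearMap.ext hπ)

/-- A map lowering degree by one commutes with projections to homogeneous components. -/
lemma proj_comp_of_degree_pred {ℳ : ℕ → Submodule R M} (hM : DirectSum.IsInternal ℳ)
    {δ : M →ₗ[R] M} (h_zero : ∀ a ∈ ℳ 0, δ a = 0) (h_deg : ∀ n, ∀ a ∈ ℳ (n + 1), δ a ∈ ℳ n)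
    {n : ℕ} {π : M →ₗ[R] ℳ n} {π' : M →ₗ[R] ℳ (n + 1)}
    (hπ : ∀ x : ℳ n, π x = x) (hπ0 : ∀ m ≠ n, ∀ x ∈ ℳ m, π x = 0)
    (hπ' : ∀ x : ℳ (n + 1), π' x = x) (hπ0' : ∀ m ≠ n + 1, ∀ x ∈ ℳ m, π' x = 0) (x : M) :
    (π (δ x) : M) = δ (π' x) := by
  have : (ℳ n).subtype ∘ₗ π ∘ₗ δ = δ ∘ₗ (ℳ (n + 1)).subtype ∘ₗ π' := by
    refine hM.linearMap_ext fun m x hx => ?_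
    rcases m with _ | m
    · simp [h_zero x hx, hπ0' 0 (by omega) x hx]
    · by_cases hmn : m = n
      · subst hmn
        have h1 := hπ ⟨δ x, h_deg m x hx⟩
        have h2 := hπ' ⟨x, hx⟩
        simp only at h1 h2
        simp [h1, h2]
      · simp [hπ0 m hmn _ (h_deg m x hx), hπ0' (m + 1) (by omega) x hx]
  exact LinearMap.congr_fun this x

lemma proj_comp_of_degree_zero {ℳ : ℕ → Submodule R M} {𝒩 : ℕ → Submodule R N}
    (hM : DirectSum.IsInternal ℳ) {g : M →ₗ[R] N} (h_deg : ∀ n, ∀ a ∈ ℳ n, g a ∈ 𝒩 n)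
    {n : ℕ} {π : M →ₗ[R] ℳ n} {ρ : N →ₗ[R] 𝒩 n}
    (hπ : ∀ x : ℳ n, π x = x) (hπ0 : ∀ m ≠ n, ∀ x ∈ ℳ m, π x = 0)
    (hρ : ∀ x : 𝒩 n, ρ x = x) (hρ0 : ∀ m ≠ n, ∀ x ∈ 𝒩 m, ρ x = 0) (x : M) :
    (ρ (g x) : N) = g (π x) := by
  have : (𝒩 n).subtype ∘ₗ ρ ∘ₗ g = g ∘ₗ (ℳ n).subtype ∘ₗ π := by
    refine hM.linearMap_ext fun m x hx => ?_
    by_cases hmn : m = n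
    · subst hmn
      have h1 := hρ ⟨g x, h_deg m x hx⟩
      have h2 := hπ ⟨x, hx⟩
      simp only at h1 h2
      simp [h1, h2]
    · simp [hπ0 m hmn x hx, hρ0 m hmn _ (h_deg m x hx)]
  exact LinearMap.congr_fun this x

/-- Acyclicity of the mapping cone of a quasi-isomorphism, in each degree. -/
lemma exists_homogeneous_cone_lift {ℳ : ℕ → Submodule R M} {𝒩 : ℕ → Submodule R N}
    (hM : DirectSum.IsInternal ℳ) (hN : DirectSum.IsInternal 𝒩)
    {δ : M →ₗ[R] M} (hδ0 : ∀ a ∈ ℳ 0, δ a = 0) (hδ : ∀ n, ∀ a ∈ ℳ (n + 1), δ a ∈ ℳ n)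
    {δ' : N →ₗ[R] N} (hδ0' : ∀ a ∈ 𝒩 0, δ' a = 0) (hδ' : ∀ n, ∀ a ∈ 𝒩 (n + 1), δ' a ∈ 𝒩 n)
    {g : M →ₗ[R] N} (hg : ∀ n, ∀ a ∈ ℳ n, g a ∈ 𝒩 n) (hg_chain : ∀ a, g (δ a) = δ' (g a))
    (hg_surj : ∀ y, δ' y = 0 → ∃ x z, δ x = 0 ∧ y = g x + δ' z)
    (hg_inj : ∀ x, δ x = 0 → (∃ z, g x = δ' z) → ∃ w, x = δ w)
    {n : ℕ} {x : M} (hx : x ∈ ℳ n) {y : N} (hy : y ∈ 𝒩 (n + 1))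
    (hδx : δ x = 0) (hxy : g x = δ' y) :
    ∃ w ∈ ℳ (n + 1), ∃ z ∈ 𝒩 (n + 2), δ w = x ∧ g w - δ' z = y := by
  obtain ⟨π, hπ, hπ0⟩ := hM.exists_proj n
  obtain ⟨π', hπ', hπ0'⟩ := hM.exists_proj (n + 1)
  obtain ⟨ρ, hρ, hρ0⟩ := hN.exists_proj (n + 1)
  obtain ⟨ρ', hρ', hρ0'⟩ := hN.exists_proj (n + 2)
  have h_dπ := proj_comp_of_degree_pred hM hδ0 hδ hπ hπ0 hπ' hπ0'
  have h_dρ := proj_comp_of_degree_pred hN hδ0' hδ' hρ hρ0 hρ' hρ0'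
  have h_gπ := proj_comp_of_degree_zero hM hg hπ' hπ0' hρ hρ0
  obtain ⟨w₀, hw₀⟩ := hg_inj x hδx ⟨y, hxy⟩
  have hw : δ (π' w₀) = x := by
    rw [← h_dπ, ← hw₀]
    exact congrArg Subtype.val (hπ ⟨x, hx⟩)
  obtain ⟨c, z, hc, hz⟩ := hg_surj (g (π' w₀) - y)
    (by rw [map_sub, ← hg_chain, hw, hxy, sub_self])
  have hz' : g (π' w₀) - y = g (π' c) + δ' (ρ' z) := by
    have h_proj := congrArg Subtype.val (hρ ⟨_, sub_mem (hg _ _ (π' w₀).2) hy⟩)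
    simp only [hz] at h_proj
    rw [hz, ← h_proj, map_add, Submodule.coe_add, h_gπ, h_dρ]
  refine ⟨π' w₀ - π' c, sub_mem (π' w₀).2 (π' c).2, ρ' z, (ρ' z).2, ?_, ?_⟩
  · rw [map_sub, hw, ← h_dπ, hc]; simp
  · rw [map_sub, sub_eq_iff_eq_add.mp hz']; abel

end Graded

section Tensor

variable {R : Type} [CommRing R] {V : Type} [AddCommGroup V] [Module R V]
  {𝒱 : ℕ → Submodule R V}

lemma one_mem_tGrade_zero : (1 : TensorAlgebra R V) ∈ tGrade R V 𝒱 0 :=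
  Submodule.mem_iSup_of_mem [] (Submodule.mem_iSup_of_mem rfl
    (by simp))

/-- Induction principle for the graded pieces of the tensor algebra. -/
lemma tGrade_le {S : ℕ → Submodule R (TensorAlgebra R V)} (h_one : 1 ∈ S 0)
    (h_mul : ∀ i n, ∀ v ∈ 𝒱 i, ∀ a ∈ S n, TensorAlgebra.ι R v * a ∈ S (i + n)) (n : ℕ) :
    tGrade R V 𝒱 n ≤ S n := by
  refine iSup_le fun l => iSup_le fun hl => ?_
  subst hl
  induction l with
  | nil => simpa [Submodule.one_le] using h_one
  | cons i l ih =>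
    rw [List.map_cons, List.prod_cons, List.sum_cons, Submodule.mul_le]
    rintro _ ⟨v, hv, rfl⟩ a ha
    exact h_mul i _ v hv a (ih ha)

lemma ι_mul_mem_tGrade {i n : ℕ} {v : V} (hv : v ∈ 𝒱 i) {a : TensorAlgebra R V}
    (ha : a ∈ tGrade R V 𝒱 n) : TensorAlgebra.ι R v * a ∈ tGrade R V 𝒱 (i + n) := by
  have : tGrade R V 𝒱 n ≤
      (tGrade R V 𝒱 (i + n)).comap (LinearMap.mulLeft R (TensorAlgebra.ι R v)) := by
    refine iSup_le fun l => iSup_le fun hl a ha => ?_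
    refine Submodule.mem_iSup_of_mem (i :: l) (Submodule.mem_iSup_of_mem (by simp [hl]) ?_)
    rw [List.map_cons, List.prod_cons]
    exact Submodule.mul_mem_mul ⟨v, hv, rfl⟩ ha
  exact this ha

lemma ι_mem_tGrade {i : ℕ} {v : V} (hv : v ∈ 𝒱 i) :
    TensorAlgebra.ι R v ∈ tGrade R V 𝒱 i := by
  simpa using ι_mul_mem_tGrade hv (one_mem_tGrade_zero (R := R) (𝒱 := 𝒱))

/-- In degrees at most `m`, the tensor algebra only involves generators of degree at most `m`. -/
lemma tGrade_le_of_le {K : Submodule R (TensorAlgebra R V)} {m : ℕ} (h_one : 1 ∈ K)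
    (h_mul : ∀ i ≤ m, ∀ v ∈ 𝒱 i, ∀ a ∈ K, TensorAlgebra.ι R v * a ∈ K) {n : ℕ} (hn : n ≤ m) :
    tGrade R V 𝒱 n ≤ K := by
  have := tGrade_le (𝒱 := 𝒱) (S := fun n => ⨅ _ : n ≤ m, K) (by simp [h_one])
    (fun i n v hv a ha => by
      simp only [Submodule.mem_iInf] at ha ⊢
      exact fun h => h_mul i (by omega) v hv a (ha (by omega))) n
  simpa [hn] using this

lemma eq_top_of_ι_mul_mem (hV : DirectSum.IsInternal 𝒱) {K : Submodule R (TensorAlgebra R V)}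
    (h_one : 1 ∈ K) (h_mul : ∀ i, ∀ v ∈ 𝒱 i, ∀ a ∈ K, TensorAlgebra.ι R v * a ∈ K) :
    K = ⊤ := by
  classical
  have h_mul' : ∀ v : V, ∀ a ∈ K, TensorAlgebra.ι R v * a ∈ K := by
    intro v a ha
    have : (⊤ : Submodule R V) ≤
        K.comap ((LinearMap.mulRight R a).comp (TensorAlgebra.ι R)) := by
      rw [← hV.submodule_iSup_eq_top]
      exact iSup_le fun i v hv => h_mul i v hv a ha
    exact this Submodule.mem_top
  have key : ∀ t : TensorAlgebra R V, ∀ a ∈ K, t * a ∈ K := by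
    intro t
    induction t using TensorAlgebra.induction with
    | algebraMap r => exact fun a ha => Algebra.smul_def r a ▸ K.smul_mem r ha
    | ι v => exact h_mul' v
    | mul s t hs ht => exact fun a ha => by rw [mul_assoc]; exact hs _ (ht _ ha)
    | add s t hs ht => exact fun a ha => by rw [add_mul]; exact add_mem (hs _ ha) (ht _ ha)
  exact eq_top_iff.mpr fun t _ => by simpa using key t 1 h_one

/-- Algebra maps agreeing on generators of degree at most `m` agree in degrees at most `m`. -/
lemma algHom_eq_of_mem_tGrade {B : Type} [Ring B] [Algebra R B]
    {p q : TensorAlgebra R V →ₐ[R] B} {m : ℕ}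
    (h : ∀ i ≤ m, ∀ v ∈ 𝒱 i, p (TensorAlgebra.ι R v) = q (TensorAlgebra.ι R v))
    {n : ℕ} (hn : n ≤ m) {a : TensorAlgebra R V} (ha : a ∈ tGrade R V 𝒱 n) : p a = q a := by
  refine tGrade_le_of_le (K := LinearMap.eqLocus p.toLinearMap q.toLinearMap) ?_ ?_ hn ha
  · simp [LinearMap.mem_eqLocus]
  · intro i hi v hv a ha
    simp only [LinearMap.mem_eqLocus, AlgHom.toLinearMap_apply, map_mul] at ha ⊢
    rw [h i hi v hv, ha]

variable {B : Type} [Ring B] [Algebra R B]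

/-- The algebra map `T(V) → M₂(B)` with upper triangular values on `V`. -/
noncomputable def triangularLift (α η β : V →ₗ[R] B) :
    TensorAlgebra R V →ₐ[R] Matrix (Fin 2) (Fin 2) B :=
  TensorAlgebra.lift R
    { toFun := fun v => !![α v, η v; 0, β v]
      map_add' := fun v w => by ext i j; fin_cases i <;> fin_cases j <;> simp
      map_smul' := fun r v => by ext i j; fin_cases i <;> fin_cases j <;> simp }

lemma triangularLift_ι (α η β : V →ₗ[R] B) (v : V) :
    triangularLift α η β (TensorAlgebra.ι R v) = !![α v, η v; 0, β v] := by
  simp [triangularLift]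

lemma triangularLift_entries (α η β : V →ₗ[R] B) (a : TensorAlgebra R V) :
    triangularLift α η β a 0 0 = TensorAlgebra.lift R α a ∧
    triangularLift α η β a 1 0 = 0 ∧
    triangularLift α η β a 1 1 = TensorAlgebra.lift R β a := by
  induction a using TensorAlgebra.induction with
  | algebraMap r => simp [Matrix.algebraMap_matrix_apply]
  | ι v => simp [triangularLift_ι]
  | mul a b ha hb => simp [Matrix.mul_apply, ha, hb]
  | add a b ha hb => simp [ha, hb]

/-- The linear map `t : T(V) → B` extending `η` such that `t (ab) = α(a) t(b) + t(a) β(b)`,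
where `α` and `β` are extended multiplicatively. -/
noncomputable def twistedDerivation (α η β : V →ₗ[R] B) : TensorAlgebra R V →ₗ[R] B :=
  (Matrix.entryLinearMap R B 0 1).comp (triangularLift α η β).toLinearMap

lemma twistedDerivation_one (α η β : V →ₗ[R] B) : twistedDerivation α η β 1 = 0 := by
  simp [twistedDerivation]

lemma twistedDerivation_ι (α η β : V →ₗ[R] B) (v : V) :
    twistedDerivation α η β (TensorAlgebra.ι R v) = η v := by
  simp [twistedDerivation, triangularLift_ι]

lemma twistedDerivation_mul (α η β : V →ₗ[R] B) (a b : TensorAlgebra R V) :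
    twistedDerivation α η β (a * b) =
      TensorAlgebra.lift R α a * twistedDerivation α η β b +
        twistedDerivation α η β a * TensorAlgebra.lift R β b := by
  simp [twistedDerivation, Matrix.mul_apply, triangularLift_entries]

lemma twistedDerivation_eq_of_mem_tGrade {α η α' η' β : V →ₗ[R] B} {m : ℕ}
    (hα : ∀ i ≤ m, ∀ v ∈ 𝒱 i, α v = α' v) (hη : ∀ i ≤ m, ∀ v ∈ 𝒱 i, η v = η' v)
    {n : ℕ} (hn : n ≤ m) {a : TensorAlgebra R V} (ha : a ∈ tGrade R V 𝒱 n) :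
    twistedDerivation α η β a = twistedDerivation α' η' β a := by
  have : triangularLift α η β a = triangularLift α' η' β a :=
    algHom_eq_of_mem_tGrade (fun i hi v hv => by
      rw [triangularLift_ι, triangularLift_ι, hα i hi v hv, hη i hi v hv]) hn ha
  exact congrFun (congrFun this 0) 1

end Tensor

section Lifting

variable {R A A' V : Type} [CommRing R] [Ring A] [Algebra R A] [Ring A'] [Algebra R A']
  [AddCommGroup V] [Module R V]

/-- A degree `-1` square-zero derivation with respect to the grading `𝒜`. -/
structure IsDGDerivation (𝒜 : ℕ → Submodule R A) (δ : A →ₗ[R] A) : Prop where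
  map_zero_piece : ∀ a ∈ 𝒜 0, δ a = 0
  map_succ_piece : ∀ n, ∀ a ∈ 𝒜 (n + 1), δ a ∈ 𝒜 n
  sq : ∀ a, δ (δ a) = 0
  leibniz : ∀ n, ∀ a ∈ 𝒜 n, ∀ b, δ (a * b) = δ a * b + ((-1 : ℤ) ^ n) • (a * δ b)

/-- The data of the Adams–Hilton lifting problem: a quasi-isomorphism `g : A → A'` and a morphism
`f' : T(V) → A'` to be lifted along `g`.  The map `s` is the sign `v ↦ (-1) ^ |v| v` on `V`. -/
structure IsLiftingProblem (𝒜 : ℕ → Submodule R A) (𝒜' : ℕ → Submodule R A')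
    (𝒱 : ℕ → Submodule R V) (dA : A →ₗ[R] A) (dA' : A' →ₗ[R] A')
    (d : TensorAlgebra R V →ₗ[R] TensorAlgebra R V) (g : A →ₐ[R] A')
    (f' : TensorAlgebra R V →ₐ[R] A') (s : V →ₗ[R] V) : Prop where
  intA : DirectSum.IsInternal 𝒜
  intA' : DirectSum.IsInternal 𝒜'
  one_mem : (1 : A) ∈ 𝒜 0
  mul_mem : ∀ m n, ∀ a ∈ 𝒜 m, ∀ b ∈ 𝒜 n, a * b ∈ 𝒜 (m + n)
  mul_mem' : ∀ m n, ∀ a ∈ 𝒜' m, ∀ b ∈ 𝒜' n, a * b ∈ 𝒜' (m + n)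
  derA : IsDGDerivation 𝒜 dA
  derA' : IsDGDerivation 𝒜' dA'
  derT : IsDGDerivation (tGrade R V 𝒱) d
  g_mem : ∀ n, ∀ a ∈ 𝒜 n, g a ∈ 𝒜' n
  g_chain : ∀ a, g (dA a) = dA' (g a)
  g_surj : ∀ y, dA' y = 0 → ∃ x z, dA x = 0 ∧ y = g x + dA' z
  g_inj : ∀ x, dA x = 0 → (∃ z, g x = dA' z) → ∃ w, x = dA w
  intV : DirectSum.IsInternal 𝒱
  V_zero : 𝒱 0 = ⊥
  f'_mem : ∀ n, ∀ a ∈ tGrade R V 𝒱 n, f' a ∈ 𝒜' n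
  f'_chain : ∀ a, f' (d a) = dA' (f' a)
  s_apply : ∀ n, ∀ v ∈ 𝒱 n, s v = ((-1 : ℤ) ^ n) • v

/-- The `(g ∘ f)`-`f'`-derivation `T(V) → A'` with value `η` on `V`, where `f` extends `φ`. -/
noncomputable def liftHomotopy (g : A →ₐ[R] A') (f' : TensorAlgebra R V →ₐ[R] A')
    (s : V →ₗ[R] V) (φ : V →ₗ[R] A) (η : V →ₗ[R] A') : TensorAlgebra R V →ₗ[R] A' :=
  twistedDerivation (g.toLinearMap ∘ₗ φ ∘ₗ s) η (f'.toLinearMap ∘ₗ TensorAlgebra.ι R)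

/-- The equations `dφ = φd` and `dη + ηd = gφ - f'` at a generator `v`. -/
def SolvesAt (dA : A →ₗ[R] A) (dA' : A' →ₗ[R] A')
    (d : TensorAlgebra R V →ₗ[R] TensorAlgebra R V) (g : A →ₐ[R] A')
    (f' : TensorAlgebra R V →ₐ[R] A') (s : V →ₗ[R] V) (φ : V →ₗ[R] A) (η : V →ₗ[R] A')
    (v : V) : Prop :=
  TensorAlgebra.lift R φ (d (TensorAlgebra.ι R v)) = dA (φ v) ∧
  dA' (η v) + liftHomotopy g f' s φ η (d (TensorAlgebra.ι R v)) =
    g (φ v) - f' (TensorAlgebra.ι R v)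

namespace IsLiftingProblem

variable {𝒜 : ℕ → Submodule R A} {𝒜' : ℕ → Submodule R A'} {𝒱 : ℕ → Submodule R V}
  {dA : A →ₗ[R] A} {dA' : A' →ₗ[R] A'} {d : TensorAlgebra R V →ₗ[R] TensorAlgebra R V}
  {g : A →ₐ[R] A'} {f' : TensorAlgebra R V →ₐ[R] A'} {s : V →ₗ[R] V}
  {φ φ' : V →ₗ[R] A} {η η' : V →ₗ[R] A'}

lemma lift_sign (P : IsLiftingProblem 𝒜 𝒜' 𝒱 dA dA' d g f' s) {n : ℕ}
    {a : TensorAlgebra R V} (ha : a ∈ tGrade R V 𝒱 n) :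
    TensorAlgebra.lift R (g.toLinearMap ∘ₗ φ ∘ₗ s) a =
      ((-1 : ℤ) ^ n) • g (TensorAlgebra.lift R φ a) := by
  refine tGrade_le (S := fun n => LinearMap.eqLocus
    (TensorAlgebra.lift R (g.toLinearMap ∘ₗ φ ∘ₗ s)).toLinearMap
    (((-1 : ℤ) ^ n) • (g.comp (TensorAlgebra.lift R φ)).toLinearMap)) ?_ ?_ n ha
  · simp [LinearMap.mem_eqLocus]
  · intro i n v hv a ha
    simp only [LinearMap.mem_eqLocus, AlgHom.toLinearMap_apply, LinearMap.smul_apply,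
      AlgHom.comp_apply, map_mul, TensorAlgebra.lift_ι_apply, LinearMap.comp_apply] at ha ⊢
    rw [ha, P.s_apply i v hv, map_zsmul, map_zsmul, smul_mul_smul_comm, pow_add]

lemma liftHomotopy_mul (P : IsLiftingProblem 𝒜 𝒜' 𝒱 dA dA' d g f' s) {n : ℕ}
    {a : TensorAlgebra R V} (ha : a ∈ tGrade R V 𝒱 n) (b : TensorAlgebra R V) :
    liftHomotopy g f' s φ η (a * b) = liftHomotopy g f' s φ η a * f' b +
      ((-1 : ℤ) ^ n) • (g (TensorAlgebra.lift R φ a) * liftHomotopy g f' s φ η b) := by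
  have hf' : TensorAlgebra.lift R (f'.toLinearMap ∘ₗ TensorAlgebra.ι R) = f' :=
    TensorAlgebra.hom_ext (by ext; simp)
  rw [liftHomotopy, twistedDerivation_mul, P.lift_sign ha, hf', smul_mul_assoc, add_comm]

lemma lift_mem (P : IsLiftingProblem 𝒜 𝒜' 𝒱 dA dA' d g f' s)
    (hφ : ∀ n, ∀ v ∈ 𝒱 n, φ v ∈ 𝒜 n) {n : ℕ} {a : TensorAlgebra R V}
    (ha : a ∈ tGrade R V 𝒱 n) : TensorAlgebra.lift R φ a ∈ 𝒜 n := by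
  refine tGrade_le (S := fun n => (𝒜 n).comap (TensorAlgebra.lift R φ).toLinearMap) ?_ ?_ n ha
  · simpa using P.one_mem
  · intro i n v hv a ha
    simpa using P.mul_mem i n _ (hφ i v hv) _ ha

lemma liftHomotopy_mem (P : IsLiftingProblem 𝒜 𝒜' 𝒱 dA dA' d g f' s)
    (hφ : ∀ n, ∀ v ∈ 𝒱 n, φ v ∈ 𝒜 n) (hη : ∀ n, ∀ v ∈ 𝒱 n, η v ∈ 𝒜' (n + 1)) {n : ℕ}
    {a : TensorAlgebra R V} (ha : a ∈ tGrade R V 𝒱 n) :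
    liftHomotopy g f' s φ η a ∈ 𝒜' (n + 1) := by
  refine (tGrade_le (S := fun n => tGrade R V 𝒱 n ⊓
    (𝒜' (n + 1)).comap (liftHomotopy g f' s φ η)) ?_ ?_ n ha).2
  · exact ⟨one_mem_tGrade_zero, by simp [liftHomotopy, twistedDerivation_one]⟩
  · rintro i n v hv a ⟨ha, hha⟩
    refine ⟨ι_mul_mem_tGrade hv ha, ?_⟩
    change liftHomotopy g f' s φ η (TensorAlgebra.ι R v * a) ∈ 𝒜' (i + n + 1)
    rw [P.liftHomotopy_mul (ι_mem_tGrade hv), TensorAlgebra.lift_ι_apply,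
      liftHomotopy, twistedDerivation_ι]
    refine add_mem ?_ (zsmul_mem ?_ _)
    · rw [add_right_comm]
      exact P.mul_mem' _ _ _ (hη i v hv) _ (P.f'_mem n a ha)
    · exact P.mul_mem' _ _ _ (P.g_mem i _ (hφ i v hv)) _ hha

lemma chain_mul (P : IsLiftingProblem 𝒜 𝒜' 𝒱 dA dA' d g f' s)
    (hφ : ∀ n, ∀ v ∈ 𝒱 n, φ v ∈ 𝒜 n) {i : ℕ} {v : V} (hv : v ∈ 𝒱 i)
    (h_solves : SolvesAt dA dA' d g f' s φ η v) {a : TensorAlgebra R V}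
    (ha : TensorAlgebra.lift R φ (d a) = dA (TensorAlgebra.lift R φ a)) :
    TensorAlgebra.lift R φ (d (TensorAlgebra.ι R v * a)) =
      dA (TensorAlgebra.lift R φ (TensorAlgebra.ι R v * a)) := by
  rw [P.derT.leibniz i _ (ι_mem_tGrade hv), map_add, map_zsmul, map_mul, map_mul, map_mul,
    TensorAlgebra.lift_ι_apply, P.derA.leibniz i _ (hφ i v hv), h_solves.1, ha]

lemma homotopy_mul (P : IsLiftingProblem 𝒜 𝒜' 𝒱 dA dA' d g f' s)
    (hφ : ∀ n, ∀ v ∈ 𝒱 n, φ v ∈ 𝒜 n) (hη : ∀ n, ∀ v ∈ 𝒱 n, η v ∈ 𝒜' (n + 1))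
    {i : ℕ} {v : V} (hv : v ∈ 𝒱 i)
    (h_solves : SolvesAt dA dA' d g f' s φ η v) {a : TensorAlgebra R V}
    (ha : dA' (liftHomotopy g f' s φ η a) + liftHomotopy g f' s φ η (d a) =
      g (TensorAlgebra.lift R φ a) - f' a) :
    dA' (liftHomotopy g f' s φ η (TensorAlgebra.ι R v * a)) +
        liftHomotopy g f' s φ η (d (TensorAlgebra.ι R v * a)) =
      g (TensorAlgebra.lift R φ (TensorAlgebra.ι R v * a)) - f' (TensorAlgebra.ι R v * a) := by
  rcases i with _ | j
  · have : v = 0 := by simpa [P.V_zero] using hv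
    simp [this]
  have hιv := ι_mem_tGrade (R := R) hv
  have h_ι : liftHomotopy g f' s φ η (TensorAlgebra.ι R v) = η v := by
    rw [liftHomotopy, twistedDerivation_ι]
  obtain ⟨h_chain, h_htpy⟩ := h_solves
  have h1 := eq_sub_of_add_eq h_htpy
  have h2 := eq_sub_of_add_eq ha
  rw [P.liftHomotopy_mul hιv, P.derT.leibniz _ _ hιv, map_add dA', map_zsmul dA', h_ι,
    P.derA'.leibniz _ _ (hη _ v hv), TensorAlgebra.lift_ι_apply,
    P.derA'.leibniz _ _ (P.g_mem _ _ (hφ _ v hv)), map_add (liftHomotopy g f' s φ η),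
    map_zsmul (liftHomotopy g f' s φ η), P.liftHomotopy_mul (P.derT.map_succ_piece _ _ hιv),
    P.liftHomotopy_mul hιv, h_ι, TensorAlgebra.lift_ι_apply, h_chain, P.g_chain, h1, h2,
    P.f'_chain, map_mul, map_mul, map_mul, TensorAlgebra.lift_ι_apply]
  rcases neg_one_pow_eq_or ℤ j with hj | hj <;> simp only [pow_succ, hj] <;> noncomm_ring

/-- The submodule of elements at which the lift and the homotopy satisfy their equations. -/
noncomputable def solutions (dA : A →ₗ[R] A) (dA' : A' →ₗ[R] A')
    (d : TensorAlgebra R V →ₗ[R] TensorAlgebra R V) (g : A →ₐ[R] A')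
    (f' : TensorAlgebra R V →ₐ[R] A') (s : V →ₗ[R] V) (φ : V →ₗ[R] A) (η : V →ₗ[R] A') :
    Submodule R (TensorAlgebra R V) :=
  LinearMap.eqLocus ((TensorAlgebra.lift R φ).toLinearMap ∘ₗ d)
      (dA ∘ₗ (TensorAlgebra.lift R φ).toLinearMap) ⊓
    LinearMap.eqLocus (dA' ∘ₗ liftHomotopy g f' s φ η + liftHomotopy g f' s φ η ∘ₗ d)
      (g.toLinearMap ∘ₗ (TensorAlgebra.lift R φ).toLinearMap - f'.toLinearMap)

lemma mem_solutions {a : TensorAlgebra R V} :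
    a ∈ solutions dA dA' d g f' s φ η ↔
      TensorAlgebra.lift R φ (d a) = dA (TensorAlgebra.lift R φ a) ∧
      dA' (liftHomotopy g f' s φ η a) + liftHomotopy g f' s φ η (d a) =
        g (TensorAlgebra.lift R φ a) - f' a := Iff.rfl

lemma one_mem_solutions (P : IsLiftingProblem 𝒜 𝒜' 𝒱 dA dA' d g f' s) :
    1 ∈ solutions dA dA' d g f' s φ η := by
  rw [mem_solutions, P.derT.map_zero_piece 1 one_mem_tGrade_zero, liftHomotopy,
    twistedDerivation_one]
  simp [P.derA.map_zero_piece 1 P.one_mem]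

lemma ι_mul_mem_solutions (P : IsLiftingProblem 𝒜 𝒜' 𝒱 dA dA' d g f' s)
    (hφ : ∀ n, ∀ v ∈ 𝒱 n, φ v ∈ 𝒜 n) (hη : ∀ n, ∀ v ∈ 𝒱 n, η v ∈ 𝒜' (n + 1))
    {i : ℕ} {v : V} (hv : v ∈ 𝒱 i)
    (h_solves : SolvesAt dA dA' d g f' s φ η v) {a : TensorAlgebra R V}
    (ha : a ∈ solutions dA dA' d g f' s φ η) :
    TensorAlgebra.ι R v * a ∈ solutions dA dA' d g f' s φ η :=
  ⟨P.chain_mul hφ hv h_solves ha.1, P.homotopy_mul hφ hη hv h_solves ha.2⟩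

lemma lift_liftHomotopy_d_congr (P : IsLiftingProblem 𝒜 𝒜' 𝒱 dA dA' d g f' s) {m i : ℕ} (hi : i ≤ m + 1)
    (hφ : ∀ j ≤ m, ∀ v ∈ 𝒱 j, φ v = φ' v) (hη : ∀ j ≤ m, ∀ v ∈ 𝒱 j, η v = η' v)
    {v : V} (hv : v ∈ 𝒱 i) :
    TensorAlgebra.lift R φ (d (TensorAlgebra.ι R v)) =
        TensorAlgebra.lift R φ' (d (TensorAlgebra.ι R v)) ∧
      liftHomotopy g f' s φ η (d (TensorAlgebra.ι R v)) =
        liftHomotopy g f' s φ' η' (d (TensorAlgebra.ι R v)) := by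
  rcases i with _ | i
  · have : v = 0 := by simpa [P.V_zero] using hv
    simp [this]
  have h_mem := P.derT.map_succ_piece i _ (ι_mem_tGrade hv)
  refine ⟨algHom_eq_of_mem_tGrade (m := m) ?_ (by omega) h_mem,
    twistedDerivation_eq_of_mem_tGrade (m := m) ?_ hη (by omega) h_mem⟩
  · intro j hj v hv
    simpa using hφ j hj v hv
  · intro j hj v hv
    simp [P.s_apply j v hv, hφ j hj v hv]

/-- Extension of a solution from generators of degree at most `m` to degree `m + 1`. -/
lemma exists_extension [Module.Free R V] (P : IsLiftingProblem 𝒜 𝒜' 𝒱 dA dA' d g f' s)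
    (hφ : ∀ n, ∀ v ∈ 𝒱 n, φ v ∈ 𝒜 n) (hη : ∀ n, ∀ v ∈ 𝒱 n, η v ∈ 𝒜' (n + 1)) {m : ℕ}
    (h_solves : ∀ i ≤ m, ∀ v ∈ 𝒱 i, SolvesAt dA dA' d g f' s φ η v) :
    ∃ (φ' : V →ₗ[R] A) (η' : V →ₗ[R] A'),
      (∀ n, ∀ v ∈ 𝒱 n, φ' v ∈ 𝒜 n) ∧ (∀ n, ∀ v ∈ 𝒱 n, η' v ∈ 𝒜' (n + 1)) ∧
      (∀ i ≤ m + 1, ∀ v ∈ 𝒱 i, SolvesAt dA dA' d g f' s φ' η' v) ∧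
      (∀ i ≤ m, ∀ v ∈ 𝒱 i, φ v = φ' v) ∧ (∀ i ≤ m, ∀ v ∈ 𝒱 i, η v = η' v) := by
  classical
  let F := TensorAlgebra.lift R φ
  let H := liftHomotopy g f' s φ η
  let D : 𝒜 (m + 1) × 𝒜' (m + 2) →ₗ[R] A × A' :=
    LinearMap.prod (dA ∘ₗ (𝒜 (m + 1)).subtype ∘ₗ LinearMap.fst R _ _)
      (g.toLinearMap ∘ₗ (𝒜 (m + 1)).subtype ∘ₗ LinearMap.fst R _ _ -
        dA' ∘ₗ (𝒜' (m + 2)).subtype ∘ₗ LinearMap.snd R _ _)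
  let θ : 𝒱 (m + 1) →ₗ[R] A × A' :=
    (LinearMap.prod (F.toLinearMap ∘ₗ d) (f'.toLinearMap + H ∘ₗ d)) ∘ₗ
      TensorAlgebra.ι R ∘ₗ (𝒱 (m + 1)).subtype
  have h_sol : tGrade R V 𝒱 m ≤ solutions dA dA' d g f' s φ η :=
    tGrade_le_of_le P.one_mem_solutions
      (fun i hi v hv a ha => P.ι_mul_mem_solutions hφ hη hv (h_solves i hi v hv) ha) le_rfl
  have hθ : ∀ v, θ v ∈ LinearMap.range D := by
    intro v
    have hv := ι_mem_tGrade (R := R) v.2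
    have hdv := P.derT.map_succ_piece _ _ hv
    obtain ⟨h_chain, h_htpy⟩ := mem_solutions.mp (h_sol hdv)
    rw [P.derT.sq, map_zero] at h_chain
    rw [P.derT.sq, map_zero, add_zero, eq_sub_iff_add_eq] at h_htpy
    obtain ⟨w, hw, z, hz, h1, h2⟩ := exists_homogeneous_cone_lift P.intA P.intA'
      P.derA.map_zero_piece P.derA.map_succ_piece P.derA'.map_zero_piece P.derA'.map_succ_piece
      (g := g.toLinearMap) P.g_mem P.g_chain P.g_surj P.g_inj (P.lift_mem hφ hdv)
      (add_mem (P.f'_mem _ _ hv) (P.liftHomotopy_mem hφ hη hdv)) h_chain.symm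
      (by rw [map_add, ← P.f'_chain]; exact h_htpy.symm.trans (add_comm _ _))
    exact ⟨(⟨w, hw⟩, ⟨z, hz⟩), Prod.ext h1 h2⟩
  have := P.intV.projective (m + 1)
  obtain ⟨ψ, hψ⟩ := Module.projective_lifting_property D.rangeRestrict
    (θ.codRestrict (LinearMap.range D) hθ) D.surjective_rangeRestrict
  have hψ' : ∀ v, D (ψ v) = θ v := fun v => congrArg Subtype.val (LinearMap.congr_fun hψ v)
  obtain ⟨Φ, hΦ⟩ := P.intV.exists_linearMap (N := A × A') fun n =>
    if h : n = m + 1 then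
      LinearMap.prodMap (𝒜 (m + 1)).subtype (𝒜' (m + 2)).subtype ∘ₗ ψ ∘ₗ
        Submodule.inclusion (h ▸ le_rfl)
    else (φ.prod η) ∘ₗ (𝒱 n).subtype
  have hΦ_ne : ∀ n ≠ m + 1, ∀ v ∈ 𝒱 n, Φ v = (φ v, η v) := by
    intro n hn v hv
    have := hΦ n ⟨v, hv⟩
    simpa [hn] using this
  have hΦ_eq : ∀ v : 𝒱 (m + 1), Φ v = ((ψ v).1.1, (ψ v).2.1) := by
    intro v
    rw [hΦ, dif_pos rfl]
    rfl
  have h_agree : ∀ i ≤ m, ∀ v ∈ 𝒱 i, φ v = (LinearMap.fst R A A' ∘ₗ Φ) v := fun i hi v hv => by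
    simp [hΦ_ne i (by omega) v hv]
  have h_agree' : ∀ i ≤ m, ∀ v ∈ 𝒱 i, η v = (LinearMap.snd R A A' ∘ₗ Φ) v := fun i hi v hv => by
    simp [hΦ_ne i (by omega) v hv]
  refine ⟨LinearMap.fst R A A' ∘ₗ Φ, LinearMap.snd R A A' ∘ₗ Φ, ?_, ?_, ?_, h_agree, h_agree'⟩
  · intro n v hv
    by_cases hn : n = m + 1
    · subst hn
      simp [hΦ_eq ⟨v, hv⟩]
    · simpa [hΦ_ne n hn v hv] using hφ n v hv
  · intro n v hv
    by_cases hn : n = m + 1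
    · subst hn
      simp [hΦ_eq ⟨v, hv⟩]
    · simpa [hΦ_ne n hn v hv] using hη n v hv
  · intro i hi v hv
    obtain ⟨h1, h2⟩ := P.lift_liftHomotopy_d_congr hi h_agree h_agree' hv
    rw [SolvesAt, ← h1, ← h2]
    rcases Nat.lt_or_eq_of_le hi with hi' | rfl
    · rw [← h_agree i (by omega) v hv, ← h_agree' i (by omega) v hv]
      exact h_solves i (by omega) v hv
    · have h := hψ' ⟨v, hv⟩
      have h3 : dA (ψ ⟨v, hv⟩).1 = F (d (TensorAlgebra.ι R v)) := congrArg Prod.fst h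
      have h4 : g (ψ ⟨v, hv⟩).1 - dA' (ψ ⟨v, hv⟩).2 =
        f' (TensorAlgebra.ι R v) + H (d (TensorAlgebra.ι R v)) := congrArg Prod.snd h
      simp only [LinearMap.comp_apply, hΦ_eq ⟨v, hv⟩, LinearMap.fst_apply, LinearMap.snd_apply]
      refine ⟨h3.symm, ?_⟩
      rw [sub_eq_iff_eq_add.mp h4]
      simp only [H]
      abel

lemma exists_solution [Module.Free R V] (P : IsLiftingProblem 𝒜 𝒜' 𝒱 dA dA' d g f' s) :
    ∃ (φ : V →ₗ[R] A) (η : V →ₗ[R] A'),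
      (∀ n, ∀ v ∈ 𝒱 n, φ v ∈ 𝒜 n) ∧ (∀ n, ∀ v ∈ 𝒱 n, η v ∈ 𝒜' (n + 1)) ∧
      ∀ i, ∀ v ∈ 𝒱 i, SolvesAt dA dA' d g f' s φ η v := by
  classical
  let Sol (m : ℕ) := {p : (V →ₗ[R] A) × (V →ₗ[R] A') //
    (∀ n, ∀ v ∈ 𝒱 n, p.1 v ∈ 𝒜 n) ∧ (∀ n, ∀ v ∈ 𝒱 n, p.2 v ∈ 𝒜' (n + 1)) ∧
    ∀ i ≤ m, ∀ v ∈ 𝒱 i, SolvesAt dA dA' d g f' s p.1 p.2 v}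
  have h_step : ∀ m (p : Sol m), ∃ q : Sol (m + 1),
      ∀ i ≤ m, ∀ v ∈ 𝒱 i, p.1.1 v = q.1.1 v ∧ p.1.2 v = q.1.2 v := by
    rintro m ⟨p, hp1, hp2, hp3⟩
    obtain ⟨φ', η', h1, h2, h3, h4, h5⟩ := P.exists_extension hp1 hp2 hp3
    exact ⟨⟨(φ', η'), h1, h2, h3⟩, fun i hi v hv => ⟨h4 i hi v hv, h5 i hi v hv⟩⟩
  choose succ_sol h_next using h_step
  let start : Sol 0 := ⟨(0, 0), by simp, by simp, fun i hi v hv => by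
    obtain rfl : i = 0 := by omega
    have : v = 0 := by simpa [P.V_zero] using hv
    simp [SolvesAt, this]⟩
  let sol : ∀ m, Sol m := fun m => Nat.rec start succ_sol m
  have h_sol : ∀ i m, i ≤ m → ∀ v ∈ 𝒱 i,
      (sol i).1.1 v = (sol m).1.1 v ∧ (sol i).1.2 v = (sol m).1.2 v := by
    intro i m him v hv
    induction m, him using Nat.le_induction with
    | base => exact ⟨rfl, rfl⟩
    | succ m him ih =>
      have := h_next m (sol m) i him v hv
      exact ⟨ih.1.trans this.1, ih.2.trans this.2⟩
  obtain ⟨φ, hφ⟩ := P.intV.exists_linearMap fun n => (sol n).1.1 ∘ₗ (𝒱 n).subtype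
  obtain ⟨η, hη⟩ := P.intV.exists_linearMap fun n => (sol n).1.2 ∘ₗ (𝒱 n).subtype
  have h_agree : ∀ m, ∀ i ≤ m, ∀ v ∈ 𝒱 i, φ v = (sol m).1.1 v := fun m i hi v hv =>
    (hφ i ⟨v, hv⟩).trans (h_sol i m hi v hv).1
  have h_agree' : ∀ m, ∀ i ≤ m, ∀ v ∈ 𝒱 i, η v = (sol m).1.2 v := fun m i hi v hv =>
    (hη i ⟨v, hv⟩).trans (h_sol i m hi v hv).2
  refine ⟨φ, η, fun n v hv => ?_, fun n v hv => ?_, fun i v hv => ?_⟩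
  · rw [h_agree n n le_rfl v hv]
    exact (sol n).2.1 n v hv
  · rw [h_agree' n n le_rfl v hv]
    exact (sol n).2.2.1 n v hv
  · obtain ⟨h1, h2⟩ := P.lift_liftHomotopy_d_congr (Nat.le_succ i) (h_agree i) (h_agree' i) hv
    rw [SolvesAt, h1, h2, h_agree i i le_rfl v hv, h_agree' i i le_rfl v hv]
    exact (sol i).2.2.2 i le_rfl v hv

end IsLiftingProblem

end Lifting

/-- classical Adams–Hilton theorem, existence part.  Let `g : A → A'`
be a quasi-isomorphism of augmented differential graded `R`-algebras, let `(T(V), d)`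
be a differential graded tensor algebra on a free graded module `V` concentrated in
degrees `≥ 1`, with `d` a square-zero degree `-1` derivation, and let
`f' : (T(V), d) → A'` be a morphism of differential graded algebras.  Then there are a
morphism `f : (T(V), d) → A` of differential graded algebras and a degree-`1` linear
map `h : T(V) → A'` with `d h + h d = g ∘ f - f'` satisfying the derivation rule
`h(ab) = h(a) f'(b) + (-1)^{|a|} (g ∘ f)(a) h(b)`. -/
theorem minimal_multi_models_stmt12 (R A A' V : Type) [CommRing R]
    [Ring A] [Algebra R A] [Ring A'] [Algebra R A']
    [AddCommGroup V] [Module R V] [Module.Free R V]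
    (𝒜 : ℕ → Submodule R A) (𝒜' : ℕ → Submodule R A')
    (hAint : DirectSum.IsInternal 𝒜) (hA'int : DirectSum.IsInternal 𝒜')
    (hA1 : (1 : A) ∈ 𝒜 0) (hA'1 : (1 : A') ∈ 𝒜' 0)
    (hAmul : ∀ m n : ℕ, ∀ a ∈ 𝒜 m, ∀ b ∈ 𝒜 n, a * b ∈ 𝒜 (m + n))
    (hA'mul : ∀ m n : ℕ, ∀ a ∈ 𝒜' m, ∀ b ∈ 𝒜' n, a * b ∈ 𝒜' (m + n))
    -- augmentations:
    (εA : A →ₐ[R] R) (εA' : A' →ₐ[R] R)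
    -- the differentials:
    (dA : A →ₗ[R] A) (dA' : A' →ₗ[R] A')
    (hdA0 : ∀ a ∈ 𝒜 0, dA a = 0) (hdAdeg : ∀ n : ℕ, ∀ a ∈ 𝒜 (n + 1), dA a ∈ 𝒜 n)
    (hdAsq : dA.comp dA = 0)
    (hdALeib : ∀ n : ℕ, ∀ a ∈ 𝒜 n, ∀ b : A,
      dA (a * b) = dA a * b + ((-1 : ℤ) ^ n) • (a * dA b))
    (hdA'0 : ∀ a ∈ 𝒜' 0, dA' a = 0) (hdA'deg : ∀ n : ℕ, ∀ a ∈ 𝒜' (n + 1), dA' a ∈ 𝒜' n)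
    (hdA'sq : dA'.comp dA' = 0)
    (hdA'Leib : ∀ n : ℕ, ∀ a ∈ 𝒜' n, ∀ b : A',
      dA' (a * b) = dA' a * b + ((-1 : ℤ) ^ n) • (a * dA' b))
    -- the quasi-isomorphism `g`:
    (g : A →ₐ[R] A')
    (hggr : ∀ n : ℕ, ∀ a ∈ 𝒜 n, g a ∈ 𝒜' n)
    (hgchain : ∀ a : A, g (dA a) = dA' (g a))
    (hgsurj : ∀ y : A', dA' y = 0 → ∃ x z, dA x = 0 ∧ y = g x + dA' z)
    (hginj : ∀ x : A, dA x = 0 → (∃ z, g x = dA' z) → ∃ w, x = dA w)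
    -- the free chain algebra `(T(V), d)`:
    (𝒱 : ℕ → Submodule R V) (hVint : DirectSum.IsInternal 𝒱) (hV0 : 𝒱 0 = ⊥)
    (d : TensorAlgebra R V →ₗ[R] TensorAlgebra R V)
    (hd0 : ∀ a ∈ tGrade R V 𝒱 (0 : ℕ), d a = 0)
    (hddeg : ∀ n : ℕ, ∀ a ∈ tGrade R V 𝒱 (n + 1), d a ∈ tGrade R V 𝒱 n)
    (hdsq : d.comp d = 0)
    (hdLeib : ∀ n : ℕ, ∀ a ∈ tGrade R V 𝒱 n, ∀ b : TensorAlgebra R V,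
      d (a * b) = d a * b + ((-1 : ℤ) ^ n) • (a * d b))
    -- the morphism `f'`:
    (f' : TensorAlgebra R V →ₐ[R] A')
    (hf'gr : ∀ n : ℕ, ∀ a ∈ tGrade R V 𝒱 n, f' a ∈ 𝒜' n)
    (hf'chain : ∀ a : TensorAlgebra R V, f' (d a) = dA' (f' a)) :
    ∃ (f : TensorAlgebra R V →ₐ[R] A) (h : TensorAlgebra R V →ₗ[R] A'),
      (∀ n : ℕ, ∀ a ∈ tGrade R V 𝒱 n, f a ∈ 𝒜 n) ∧
      (∀ a : TensorAlgebra R V, f (d a) = dA (f a)) ∧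
      (∀ n : ℕ, ∀ a ∈ tGrade R V 𝒱 n, h a ∈ 𝒜' (n + 1)) ∧
      (∀ a : TensorAlgebra R V, dA' (h a) + h (d a) = g (f a) - f' a) ∧
      (∀ n : ℕ, ∀ a ∈ tGrade R V 𝒱 n, ∀ b : TensorAlgebra R V,
        h (a * b) = h a * f' b + ((-1 : ℤ) ^ n) • (g (f a) * h b)) := by
  obtain ⟨s, hs⟩ := hVint.exists_linearMap fun n => ((-1 : ℤ) ^ n) • (𝒱 n).subtype
  have P : IsLiftingProblem 𝒜 𝒜' 𝒱 dA dA' d g f' s :=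
    { intA := hAint, intA' := hA'int, one_mem := hA1
      mul_mem := hAmul, mul_mem' := hA'mul
      derA := ⟨hdA0, hdAdeg, LinearMap.congr_fun hdAsq, hdALeib⟩
      derA' := ⟨hdA'0, hdA'deg, LinearMap.congr_fun hdA'sq, hdA'Leib⟩
      derT := ⟨hd0, hddeg, LinearMap.congr_fun hdsq, hdLeib⟩
      g_mem := hggr, g_chain := hgchain, g_surj := hgsurj, g_inj := hginj
      intV := hVint, V_zero := hV0, f'_mem := hf'gr, f'_chain := hf'chain
      s_apply := fun n v hv => hs n ⟨v, hv⟩ }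
  obtain ⟨φ, η, hφ, hη, h_solves⟩ := P.exists_solution
  have h_top : IsLiftingProblem.solutions dA dA' d g f' s φ η = ⊤ :=
    eq_top_of_ι_mul_mem hVint P.one_mem_solutions fun i v hv _ ha =>
      P.ι_mul_mem_solutions hφ hη hv (h_solves i v hv) ha
  have h_mem : ∀ a, a ∈ IsLiftingProblem.solutions dA dA' d g f' s φ η :=
    fun a => h_top ▸ Submodule.mem_top
  exact ⟨TensorAlgebra.lift R φ, liftHomotopy g f' s φ η, fun n a ha => P.lift_mem hφ ha,
    fun a => (h_mem a).1, fun n a ha => P.liftHomotopy_mem hφ hη ha, fun a => (h_mem a).2,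
    fun n a ha b => P.liftHomotopy_mul ha b⟩
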